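/- arXiv:2211.15747 — 3 statements merged into one kernel-verified Lean document; each statement's English description precedes it below -/
import Mathlib

section
/- Let m be a positive integer and L, M, N ⊆ [m] with L ≠ [m], M ≠ [m] and N ≠ [m]. Let D = (1+u^2)Δ_L^c + u^2(Δ_M^c + (u+u^2)Δ_N^c) ⊆ R^m. Then C_D has length |D| = (2^m − 2^{|L|})(2^m − 2^{|M|})(2^m − 2^{|N|}), the map c_D : R^m → C_D is injective (its kernel is trivial), and |C_D| = 2^{3m}; in particular the only v ∈ R^m with wt_L(c_D(v)) = 0 is v = 0. Moreover, the number of v ∈ R^m with wt_L(c_D(v)) = 3·(2^m − 2^{|L|})(2^m − 2^{|M|})(2^{m−1} − 2^{|N|−1}) equals 2^{3m} − 2^{3m−|L|−|M|} − 2^{3m−|L|−|M|−|N|+1} + 2^{3m−|L|−|M|−|M∪N|+1}. -/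
open Polynomial
open scoped Classical

noncomputable section

/-- The ring `R = Z₂[u]/⟨u³ - u⟩`. -/
abbrev Rng : Type := AdjoinRoot (X ^ 3 - X : Polynomial (ZMod 2))

/-- The image `u` of the variable in `R`. -/
def u : Rng := AdjoinRoot.root (X ^ 3 - X : Polynomial (ZMod 2))

/-- The natural inclusion of `Z₂` into `R`. -/
def toRng : ZMod 2 →+* Rng := AdjoinRoot.of _

lemma cubic_monic : (X ^ 3 - X : Polynomial (ZMod 2)).Monic :=
  Polynomial.monic_X_pow_sub (n := 3) (Polynomial.degree_X_le.trans_lt (by norm_num))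

/-- The Gray map `Φ : R → Z₂³`, `Φ(a + u b + u² d) = (a + b, b + d, d)`:
every element of `R` is represented by a unique polynomial of degree `< 3`,
whose coefficients are `a, b, d`. -/
def Phi (r : Rng) : Fin 3 → ZMod 2 :=
  ![(AdjoinRoot.modByMonicHom cubic_monic r).coeff 0 +
      (AdjoinRoot.modByMonicHom cubic_monic r).coeff 1,
    (AdjoinRoot.modByMonicHom cubic_monic r).coeff 1 +
      (AdjoinRoot.modByMonicHom cubic_monic r).coeff 2,
    (AdjoinRoot.modByMonicHom cubic_monic r).coeff 2]

/-- The support of a vector in `Z₂^m`. -/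
def supp {m : ℕ} (v : Fin m → ZMod 2) : Finset (Fin m) :=
  Finset.univ.filter (fun i => v i = 1)

/-- The simplicial complex `Δ_X` generated by `X ⊆ [m]`. -/
def Δ {m : ℕ} (X : Finset (Fin m)) : Finset (Fin m → ZMod 2) :=
  Finset.univ.filter (fun v => supp v ⊆ X)

/-- The Lee weight of a tuple over `R`: the Hamming weight of its coordinatewise Gray image. -/
def wtL {ι : Type} [Fintype ι] (x : ι → Rng) : ℕ :=
  ∑ i, (Finset.univ.filter (fun j : Fin 3 => Phi (x i) j ≠ 0)).card

/-- The defining set `D = (1+u²)D₁ + u²(D₂ + (u+u²)D₃) ⊆ R^m`. -/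
def Dset {m : ℕ} (D1 D2 D3 : Finset (Fin m → ZMod 2)) : Finset (Fin m → Rng) :=
  ((D1 ×ˢ D2) ×ˢ D3).image (fun t i =>
    (1 + u ^ 2) * toRng (t.1.1 i) +
      u ^ 2 * (toRng (t.1.2 i) + (u + u ^ 2) * toRng (t.2 i)))

/-- The codeword `c_D(v) = (v ⬝ d)_{d ∈ D}` of `C_D`. -/
def cD {m : ℕ} (D : Finset (Fin m → Rng)) (v : Fin m → Rng) : D → Rng :=
  fun d => ∑ i, v i * d.1 i


lemma u_cube : u ^ 3 = u := by
  have h := AdjoinRoot.mk_self (f := (X ^ 3 - X : Polynomial (ZMod 2)))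
  rw [map_sub, map_pow, AdjoinRoot.mk_X] at h
  exact sub_eq_zero.mp h

lemma two_rng : (2 : Rng) = 0 := by
  have h : toRng 2 = 0 := by
    rw [show (2 : ZMod 2) = 0 from by decide, map_zero]
  rw [← h]
  exact (map_ofNat toRng 2).symm

/-- The coordinates `(1+u²)a + u²(b + (u+u²)c)`. -/
def EE (a b c : ZMod 2) : Rng :=
  (1 + u ^ 2) * toRng a + u ^ 2 * (toRng b + (u + u ^ 2) * toRng c)

lemma EE_eq (a b c : ZMod 2) :
    EE a b c = toRng a + u * toRng c + u ^ 2 * toRng (a + b + c) := by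
  simp only [EE, map_add]
  linear_combination (toRng c * (1 + u)) * u_cube

lemma modBy_std (a b c : ZMod 2) :
    AdjoinRoot.modByMonicHom cubic_monic (toRng a + u * toRng b + u ^ 2 * toRng c) =
      C a + C b * X + C c * X ^ 2 := by
  have h : toRng a + u * toRng b + u ^ 2 * toRng c =
      AdjoinRoot.mk (X ^ 3 - X : Polynomial (ZMod 2)) (C a + C b * X + C c * X ^ 2) := by
    simp only [map_add, map_mul, map_pow, AdjoinRoot.mk_X, AdjoinRoot.mk_C]
    simp only [toRng, u]
    ring
  rw [h, AdjoinRoot.modByMonicHom_mk, Polynomial.modByMonic_eq_self_iff cubic_monic]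
  have h3 : (X ^ 3 - X : Polynomial (ZMod 2)).degree = 3 := by
    compute_degree!
  rw [h3]
  have : (C a + C b * X + C c * X ^ 2 : Polynomial (ZMod 2)).degree ≤ 2 := by
    compute_degree
  exact lt_of_le_of_lt this (by norm_num)

lemma Phi_EE (a b c : ZMod 2) : Phi (EE a b c) = ![a + c, a + b, a + b + c] := by
  have h : c + (a + b + c) = a + b := by
    revert a b c; decide
  simp only [Phi, EE_eq, modBy_std]
  generalize a + b + c = d at h ⊢
  simp [coeff_X, coeff_C, h]

lemma EE_surj (r : Rng) : ∃ a b c, EE a b c = r := by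
  obtain ⟨p, rfl⟩ := AdjoinRoot.mk_surjective (g := (X ^ 3 - X : Polynomial (ZMod 2))) r
  have h3 : (X ^ 3 - X : Polynomial (ZMod 2)).degree = 3 := by
    compute_degree!
  have hq : AdjoinRoot.mk (X ^ 3 - X : Polynomial (ZMod 2)) p =
      AdjoinRoot.mk _ (p %ₘ (X ^ 3 - X)) :=
    (AdjoinRoot.mk_leftInverse cubic_monic _).symm
  rw [hq]
  have hd := Polynomial.degree_modByMonic_lt p cubic_monic
  rw [h3] at hd
  generalize p %ₘ (X ^ 3 - X : Polynomial (ZMod 2)) = q at hd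
  have hqq : q = C (q.coeff 0) + C (q.coeff 1) * X + C (q.coeff 2) * X ^ 2 := by
    have hn : q.natDegree < 3 := by
      by_cases h0 : q = 0
      · simp [h0]
      · exact (Polynomial.natDegree_lt_iff_degree_lt h0).2 hd
    conv_lhs => rw [Polynomial.as_sum_range_C_mul_X_pow' q hn]
    simp [Finset.sum_range_succ]
  refine ⟨q.coeff 0, q.coeff 2 - q.coeff 0 - q.coeff 1, q.coeff 1, ?_⟩
  rw [EE_eq]
  conv_rhs => rw [hqq]
  simp only [map_add, map_mul, map_pow, AdjoinRoot.mk_X, AdjoinRoot.mk_C, map_sub]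
  simp only [toRng, u]
  ring

lemma EE_inj {a b c a' b' c' : ZMod 2} (h : EE a b c = EE a' b' c') :
    a = a' ∧ b = b' ∧ c = c' := by
  have h1 := congrArg Phi h
  rw [Phi_EE, Phi_EE] at h1
  have e0 := congrFun h1 0
  have e1 := congrFun h1 1
  have e2 := congrFun h1 2
  simp at e0 e1 e2
  clear h h1
  revert a b c a' b' c'
  decide

lemma EE_mul (a b c a' b' c' : ZMod 2) :
    EE a b c * EE a' b' c' = EE (a * a') (b * b') (b * c' + c * b') := by
  simp only [EE, map_add, map_mul]
  generalize toRng a = a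
  generalize toRng b = b
  generalize toRng c = c
  generalize toRng a' = a'
  generalize toRng b' = b'
  generalize toRng c' = c'
  have h4 : u ^ 4 = u ^ 2 := by linear_combination u * u_cube
  have h5 : u ^ 5 = u := by linear_combination (u ^ 2 + 1) * u_cube
  have h6 : u ^ 6 = u ^ 2 := by linear_combination (u ^ 3 + u) * u_cube
  have h7 : u ^ 7 = u := by linear_combination (u ^ 4 + u ^ 2 + 1) * u_cube
  have h8 : u ^ 8 = u ^ 2 := by linear_combination (u ^ 5 + u ^ 3 + u) * u_cube
  ring_nf
  rw [h8, h7, h6, h5, h4, u_cube]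
  have t := two_rng
  ring_nf
  grind

lemma EE_sum {ι : Type} (s : Finset ι) (f g h : ι → ZMod 2) :
    ∑ i ∈ s, EE (f i) (g i) (h i) = EE (∑ i ∈ s, f i) (∑ i ∈ s, g i) (∑ i ∈ s, h i) := by
  simp only [EE, map_sum, Finset.sum_add_distrib, Finset.mul_sum, mul_add]

/-- vector version -/
def EV {m : ℕ} (t : ((Fin m → ZMod 2) × (Fin m → ZMod 2)) × (Fin m → ZMod 2)) : Fin m → Rng :=
  fun i => EE (t.1.1 i) (t.1.2 i) (t.2 i)

lemma EV_bij {m : ℕ} : Function.Bijective (EV (m := m)) := by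
  constructor
  · rintro ⟨⟨a, b⟩, c⟩ ⟨⟨a', b'⟩, c'⟩ h
    have := fun i => EE_inj (congrFun h i)
    simp only [Prod.mk.injEq]
    exact ⟨⟨funext fun i => (this i).1, funext fun i => (this i).2.1⟩,
      funext fun i => (this i).2.2⟩
  · intro v
    choose a b c h using fun i => EE_surj (v i)
    exact ⟨((a, b), c), funext h⟩

/-- dot product -/
def dt {m : ℕ} (a b : Fin m → ZMod 2) : ZMod 2 := ∑ i, a i * b i

lemma EV_dot {m : ℕ} (v t : ((Fin m → ZMod 2) × (Fin m → ZMod 2)) × (Fin m → ZMod 2)) :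
    ∑ i, EV v i * EV t i =
      EE (dt v.1.1 t.1.1) (dt v.1.2 t.1.2) (dt v.1.2 t.2 + dt v.2 t.1.2) := by
  simp only [EV, EE_mul, EE_sum, dt, Finset.sum_add_distrib]

lemma Dset_eq {m : ℕ} (D1 D2 D3 : Finset (Fin m → ZMod 2)) :
    Dset D1 D2 D3 = ((D1 ×ˢ D2) ×ˢ D3).image EV := rfl

/-- the sign character -/
def sg (x : ZMod 2) : ℤ := if x = 0 then 1 else -1

lemma sg_add (x y : ZMod 2) : sg (x + y) = sg x * sg y := by
  revert x y; unfold sg; decide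

lemma sg_sum {ι : Type} (s : Finset ι) (f : ι → ZMod 2) : sg (∑ i ∈ s, f i) = ∏ i ∈ s, sg (f i) := by
  induction s using Finset.induction_on with
  | empty => simp [sg]
  | insert a s ha ih => rw [Finset.sum_insert ha, Finset.prod_insert ha, sg_add, ih]

lemma wt_EE (a b c : ZMod 2) :
    2 * ((Finset.univ.filter (fun j : Fin 3 => Phi (EE a b c) j ≠ 0)).card : ℤ) =
      3 - (sg (a + c) + sg (a + b) + sg (a + b + c)) := by
  rw [Phi_EE, Finset.card_filter, Fin.sum_univ_three]
  simp only [Matrix.cons_val_zero, Matrix.cons_val_one, Matrix.cons_val, sg]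
  push_cast
  generalize a + c = x
  generalize a + b + c = z
  generalize a + b = y
  by_cases hx : x = 0 <;> by_cases hy : y = 0 <;> by_cases hz : z = 0 <;> simp [hx, hy, hz]

/-- vanishing on `X` -/
def Z {m : ℕ} (X : Finset (Fin m)) (a : Fin m → ZMod 2) : Prop := ∀ i ∈ X, a i = 0

lemma mem_Δ {m : ℕ} (X : Finset (Fin m)) (v : Fin m → ZMod 2) :
    v ∈ Δ X ↔ ∀ i, i ∉ X → v i = 0 := by
  have h01 : ∀ x : ZMod 2, x ≠ 1 ↔ x = 0 := by decide
  simp only [Δ, supp, Finset.mem_filter, Finset.mem_univ, true_and, Finset.subset_iff]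
  refine forall_congr' fun i => ?_
  rw [← h01]
  tauto

lemma sum_Δ {m : ℕ} (X : Finset (Fin m)) (a : Fin m → ZMod 2) :
    ∑ t ∈ Δ X, sg (dt a t) = if Z X a then 2 ^ X.card else 0 := by
  have h : Δ X = Fintype.piFinset (fun i => if i ∈ X then Finset.univ else {0}) := by
    ext v
    rw [mem_Δ, Fintype.mem_piFinset]
    refine forall_congr' fun i => ?_
    by_cases hi : i ∈ X <;> simp [hi]
  have key : ∀ i, (∑ x ∈ (if i ∈ X then Finset.univ else {0} : Finset (ZMod 2)), sg (a i * x)) =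
      if i ∈ X then (if a i = 0 then 2 else 0) else 1 := by
    intro i
    by_cases hi : i ∈ X
    · simp only [hi, if_true]
      generalize a i = y
      have : ∀ y : ZMod 2, ∑ x : ZMod 2, sg (y * x) = if y = 0 then 2 else 0 := by
        unfold sg; decide
      exact this y
    · simp [hi, sg]
  simp only [dt, sg_sum]
  rw [h, ← Finset.prod_univ_sum (fun i => if i ∈ X then Finset.univ else {0})
    (fun i x => sg (a i * x))]
  simp only [key]
  rw [Finset.prod_ite_mem]
  simp only [Finset.univ_inter]
  by_cases hz : Z X a
  · rw [if_pos hz, Finset.prod_congr rfl (fun i hi => if_pos (hz i hi))]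
    simp
  · rw [if_neg hz]
    simp only [Z, not_forall] at hz
    obtain ⟨i, hi, hne⟩ := hz
    exact Finset.prod_eq_zero hi (if_neg hne)

lemma Δ_univ {m : ℕ} : Δ (Finset.univ : Finset (Fin m)) = Finset.univ := by
  ext v; simp [mem_Δ]

lemma Z_univ {m : ℕ} (a : Fin m → ZMod 2) : Z Finset.univ a ↔ a = 0 := by
  simp [Z, funext_iff]

lemma Z_zero {m : ℕ} (X : Finset (Fin m)) : Z X 0 := by
  simp [Z]

/-- character sum over the complement -/
def chi {m : ℕ} (X : Finset (Fin m)) (a : Fin m → ZMod 2) : ℤ := ∑ t ∈ (Δ X)ᶜ, sg (dt a t)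

lemma chi_eq {m : ℕ} (X : Finset (Fin m)) (a : Fin m → ZMod 2) :
    chi X a = (if a = 0 then 2 ^ m else 0) - (if Z X a then 2 ^ X.card else 0) := by
  have h1 := sum_Δ X a
  have h2 := sum_Δ Finset.univ a
  rw [Δ_univ] at h2
  simp only [Z_univ, Finset.card_univ, Fintype.card_fin] at h2
  have h3 := Finset.sum_add_sum_compl (Δ X) (fun t => sg (dt a t))
  rw [← h1, ← h2, chi, ← h3]
  ring

lemma chi_zero {m : ℕ} (X : Finset (Fin m)) : chi X 0 = 2 ^ m - 2 ^ X.card := by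
  rw [chi_eq]; simp [Z_zero]

lemma card_chi {m : ℕ} (X : Finset (Fin m)) : (((Δ X)ᶜ).card : ℤ) = chi X 0 := by
  simp [chi, dt, sg]

lemma card_Z {m : ℕ} (X : Finset (Fin m)) :
    (Finset.univ.filter (fun a : Fin m → ZMod 2 => Z X a)).card = 2 ^ (m - X.card) := by
  have h : Finset.univ.filter (fun a : Fin m → ZMod 2 => Z X a) = Δ Xᶜ := by
    ext v
    rw [Finset.mem_filter, mem_Δ]
    simp [Z]
  rw [h]
  have h1 := sum_Δ Xᶜ (0 : Fin m → ZMod 2)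
  simp only [dt, sg, Z_zero, if_true, Pi.zero_apply, zero_mul, Finset.sum_const_zero,
    Finset.sum_const, nsmul_eq_mul, mul_one, Finset.card_compl, Fintype.card_fin] at h1
  exact_mod_cast h1

lemma pow_split {m : ℕ} (X : Finset (Fin m)) (hX : X ≠ Finset.univ) :
    ∃ P : ℤ, 1 ≤ P ∧ (2 : ℤ) ^ m = 2 ^ X.card * (2 * P) := by
  have hlt : X.card < m := by
    have := (Finset.card_lt_iff_ne_univ X).2 hX
    simpa using this
  refine ⟨2 ^ (m - X.card - 1), one_le_pow₀ (by norm_num), ?_⟩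
  rw [← pow_succ', ← pow_add]
  congr 1
  omega

lemma dt_add {m : ℕ} (a b t : Fin m → ZMod 2) : dt (a + b) t = dt a t + dt b t := by
  simp [dt, add_mul, Finset.sum_add_distrib]

lemma wtL_eq {m : ℕ} (L M N : Finset (Fin m)) (α β γ : Fin m → ZMod 2) :
    2 * (wtL (cD (Dset ((Δ L)ᶜ) ((Δ M)ᶜ) ((Δ N)ᶜ)) (EV ((α, β), γ))) : ℤ) =
      3 * (chi L 0 * chi M 0 * chi N 0) -
        chi L α * (chi M γ * chi N β + chi M β * chi N 0 + chi M (β + γ) * chi N β) := by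
  have h0 : wtL (cD (Dset ((Δ L)ᶜ) ((Δ M)ᶜ) ((Δ N)ᶜ)) (EV ((α, β), γ))) =
      ∑ t ∈ ((Δ L)ᶜ ×ˢ (Δ M)ᶜ) ×ˢ (Δ N)ᶜ, (Finset.univ.filter (fun j : Fin 3 =>
        Phi (∑ i, EV ((α, β), γ) i * EV t i) j ≠ 0)).card := by
    rw [Dset_eq]
    unfold wtL cD
    rw [Finset.sum_coe_sort (((Δ L)ᶜ ×ˢ (Δ M)ᶜ) ×ˢ (Δ N)ᶜ |>.image EV)
      (fun d => (Finset.univ.filter (fun j : Fin 3 =>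
        Phi (∑ i, EV ((α, β), γ) i * d i) j ≠ 0)).card)]
    rw [Finset.sum_image (fun x _ y _ h => EV_bij.1 h)]
  rw [h0]
  push_cast
  rw [Finset.mul_sum]
  simp only [EV_dot, wt_EE]
  simp only [Finset.sum_sub_distrib, Finset.sum_add_distrib]
  have e0 : ∑ t ∈ ((Δ L)ᶜ ×ˢ (Δ M)ᶜ) ×ˢ (Δ N)ᶜ, (3 : ℤ) = 3 * (chi L 0 * chi M 0 * chi N 0) := by
    rw [Finset.sum_const, Finset.card_product, Finset.card_product, nsmul_eq_mul]
    push_cast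
    rw [card_chi, card_chi, card_chi]
    ring
  have gen : ∀ (f g h : (Fin m → ZMod 2)),
      ∑ t ∈ ((Δ L)ᶜ ×ˢ (Δ M)ᶜ) ×ˢ (Δ N)ᶜ, sg (dt f t.1.1) * sg (dt g t.1.2) * sg (dt h t.2) =
        chi L f * chi M g * chi N h := by
    intro f g h
    rw [Finset.sum_product, chi, chi, chi]
    simp only [← Finset.mul_sum]
    rw [← Finset.sum_mul, Finset.sum_product]
    simp only [← Finset.mul_sum]
    rw [← Finset.sum_mul]
  have s0 : ∀ t : Fin m → ZMod 2, sg (dt 0 t) = 1 := by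
    intro t; simp [dt, sg]
  rw [e0]
  have e1 := gen α γ β
  have e2 := gen α β 0
  have e3 := gen α (β + γ) β
  simp only [s0, dt_add, sg_add] at e1 e2 e3 ⊢
  have f1 : ∀ x : ((Fin m → ZMod 2) × (Fin m → ZMod 2)) × (Fin m → ZMod 2),
    sg (dt α x.1.1) * (sg (dt β x.2) * sg (dt γ x.1.2)) =
      sg (dt α x.1.1) * sg (dt γ x.1.2) * sg (dt β x.2) := fun x => by ring
  have f3 : ∀ x : ((Fin m → ZMod 2) × (Fin m → ZMod 2)) × (Fin m → ZMod 2),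
    sg (dt α x.1.1) * sg (dt β x.1.2) * (sg (dt β x.2) * sg (dt γ x.1.2)) =
      sg (dt α x.1.1) * (sg (dt β x.1.2) * sg (dt γ x.1.2)) * sg (dt β x.2) := fun x => by ring
  simp only [mul_one] at e2
  simp only [f1, f3, e1, e2, e3]
  ring

lemma chi_ne {m : ℕ} (X : Finset (Fin m)) (hX : X ≠ Finset.univ) (a : Fin m → ZMod 2) :
    chi X a ≠ 0 ↔ Z X a := by
  obtain ⟨P, hP, h⟩ := pow_split X hX
  have hy : (0 : ℤ) < 2 ^ X.card := by positivity
  rw [chi_eq]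
  by_cases h0 : a = 0
  · subst h0
    simp only [if_true, Z_zero, iff_true, h]
    nlinarith
  · by_cases hz : Z X a <;> simp [h0, hz]

lemma Z_add {m : ℕ} {X : Finset (Fin m)} {a b : Fin m → ZMod 2} (ha : Z X a) :
    Z X (a + b) ↔ Z X b := by
  unfold Z at *
  refine forall₂_congr fun i hi => ?_
  simp [ha i hi]

lemma Z_add' {m : ℕ} {X : Finset (Fin m)} {a b : Fin m → ZMod 2} (hb : Z X b) :
    Z X (a + b) ↔ Z X a := by
  rw [add_comm, Z_add hb]

lemma add_eq_zero_vec {m : ℕ} (a b : Fin m → ZMod 2) : a + b = 0 ↔ a = b := by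
  have : ∀ x y : ZMod 2, x + y = 0 ↔ x = y := by decide
  simp [funext_iff, this]

lemma bracket_ne {m : ℕ} (M N : Finset (Fin m)) (hM : M ≠ Finset.univ) (hN : N ≠ Finset.univ)
    (β γ : Fin m → ZMod 2) :
    chi M γ * chi N β + chi M β * chi N 0 + chi M (β + γ) * chi N β ≠ 0 ↔
      (Z M β ∨ (Z N β ∧ (Z M γ ∨ Z M (β + γ)))) := by
  by_cases hb : Z M β
  · simp only [hb, true_or, iff_true]
    obtain ⟨P, hP, h⟩ := pow_split M hM
    obtain ⟨Q, hQ, h'⟩ := pow_split N hN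
    have hy : (0 : ℤ) < 2 ^ M.card := by positivity
    have hz : (0 : ℤ) < 2 ^ N.card := by positivity
    simp only [chi_eq, Z_add hb, add_eq_zero_vec, hb, Z_zero, if_true]
    generalize (2 : ℤ) ^ M.card = y at *
    generalize (2 : ℤ) ^ N.card = z at *
    generalize (2 : ℤ) ^ m = x at *
    have hyz : 0 < y * z := mul_pos hy hz
    have hx : x * z = y * z * (2 * P) := by rw [h]; ring
    have hx' : x * y = y * z * (2 * Q) := by rw [h']; ring
    have hxx : x * x = y * z * (4 * P * Q) := by nth_rw 1 [h]; rw [h']; ring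
    have fin : ∀ k : ℤ, k ≠ 0 → y * z * k ≠ 0 := fun k hk => mul_ne_zero hyz.ne' hk
    by_cases b0 : β = 0
    · subst b0
      simp only [if_true, Z_zero, @eq_comm _ (0 : Fin m → ZMod 2) γ]
      by_cases g0 : γ = 0
      · subst g0
        simp only [if_true, Z_zero]
        have := fin (3 * ((2 * P - 1) * (2 * Q - 1))) (by
          have : (0:ℤ) < (2 * P - 1) * (2 * Q - 1) := mul_pos (by omega) (by omega)
          omega)
        intro hh; apply this; linear_combination hh - 3 * hxx + 3 * hx + 3 * hx'
      · by_cases gz : Z M γ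
        · simp only [g0, gz, if_true, if_false]
          have := fin ((2 * P - 3) * (2 * Q - 1)) (mul_ne_zero (by omega) (by omega))
          intro hh; apply this; linear_combination hh - hxx + hx + 3 * hx'
        · simp only [g0, gz, if_false]
          have := fin ((2 * P - 1) * (2 * Q - 1)) (mul_ne_zero (by omega) (by omega))
          intro hh; apply this; linear_combination hh - hxx + hx + hx'
    · simp only [b0, if_false]
      by_cases bn : Z N β
      · simp only [bn, if_true]
        by_cases gz : Z M γ
        · simp only [gz, if_true]
          by_cases g0 : γ = 0
          · subst g0
            simp only [b0, if_true, if_false]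
            have := fin (3 - 2 * P - 2 * Q) (by omega)
            intro hh; apply this; linear_combination hh + hx + hx'
          · by_cases gb : β = γ
            · simp only [g0, gb, if_true, if_false]
              have := fin (3 - 2 * P - 2 * Q) (by omega)
              intro hh; apply this; linear_combination hh + hx + hx'
            · simp only [g0, gb, if_false]
              have := fin (3 - 2 * Q) (by omega)
              intro hh; apply this; linear_combination hh + hx'
        · have g0 : γ ≠ 0 := fun h => gz (h ▸ Z_zero M)
          have gb : β ≠ γ := fun h => gz (h ▸ hb)
          simp only [gz, g0, gb, if_false]
          have := fin (1 - 2 * Q) (by omega)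
          intro hh; apply this; linear_combination hh + hx'
      · simp only [bn, if_false]
        have := fin (1 - 2 * Q) (by omega)
        intro hh; apply this; linear_combination hh + hx'
  · have e : chi M β = 0 := by
      by_contra h; exact hb ((chi_ne M hM β).1 h)
    have e2 : chi M γ * chi N β + chi M β * chi N 0 + chi M (β + γ) * chi N β =
      chi N β * (chi M γ + chi M (β + γ)) := by rw [e]; ring
    rw [e2, mul_ne_zero_iff, chi_ne N hN]
    simp only [hb, false_or]
    refine and_congr_right fun _ => ?_
    by_cases g : Z M γ
    · have : ¬ Z M (β + γ) := by rwa [Z_add' g]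
      have e3 : chi M (β + γ) = 0 := by
        by_contra h; exact this ((chi_ne M hM _).1 h)
      rw [e3, add_zero, chi_ne M hM]
      simp [this]
    · have e3 : chi M γ = 0 := by
        by_contra h; exact g ((chi_ne M hM _).1 h)
      rw [e3, zero_add, chi_ne M hM]
      simp [g]

lemma card_pair {m : ℕ} (M N : Finset (Fin m)) :
    ((Finset.univ.filter (fun p : (Fin m → ZMod 2) × (Fin m → ZMod 2) =>
      Z M p.1 ∨ (Z N p.1 ∧ (Z M p.2 ∨ Z M (p.1 + p.2))))).card : ℤ) =
      2 ^ m * 2 ^ (m - M.card) +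
        2 * 2 ^ (m - M.card) * (2 ^ (m - N.card) - 2 ^ (m - (M ∪ N).card)) := by
  rw [Finset.card_filter, ← Finset.univ_product_univ, Finset.sum_product]
  push_cast
  have inner : ∀ β : Fin m → ZMod 2,
      (∑ γ : Fin m → ZMod 2, if Z M β ∨ (Z N β ∧ (Z M γ ∨ Z M (β + γ))) then (1 : ℤ) else 0) =
      2 ^ m * (if Z M β then 1 else 0) + 2 * 2 ^ (m - M.card) *
        ((if Z N β then 1 else 0) - (if Z (M ∪ N) β then 1 else 0)) := by
    intro β
    have hu : Z (M ∪ N) β ↔ Z M β ∧ Z N β := by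
      simp only [Z, Finset.mem_union, or_imp, forall_and]
    rw [hu]
    by_cases hb : Z M β
    · by_cases hn : Z N β <;> simp [hb, hn]
    · by_cases hn : Z N β
      · simp only [hb, hn, true_and, false_or, false_and, if_true, if_false]
        have : ∀ γ : Fin m → ZMod 2, (if Z M γ ∨ Z M (β + γ) then (1 : ℤ) else 0) =
            (if Z M γ then 1 else 0) + (if Z M (β + γ) then 1 else 0) := by
          intro γ
          by_cases g : Z M γ
          · simp [g, Z_add' g, hb]
          · simp [g]
        simp only [this, Finset.sum_add_distrib]
        rw [Fintype.sum_equiv (Equiv.addLeft β) (fun γ => if Z M (β + γ) then (1 : ℤ) else 0)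
          (fun γ => if Z M γ then (1 : ℤ) else 0) (fun γ => rfl)]
        have := card_Z M
        rw [Finset.card_filter] at this
        have h2 : (∑ γ : Fin m → ZMod 2, if Z M γ then (1 : ℤ) else 0) = 2 ^ (m - M.card) := by
          exact_mod_cast this
        rw [h2]; ring
      · simp [hb, hn]
  simp only [inner, Finset.sum_add_distrib, ← Finset.mul_sum, Finset.sum_sub_distrib]
  have c : ∀ X : Finset (Fin m), (∑ γ : Fin m → ZMod 2, if Z X γ then (1 : ℤ) else 0) =
      2 ^ (m - X.card) := by
    intro X
    have := card_Z X
    rw [Finset.card_filter] at this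
    exact_mod_cast this
  simp only [c]

lemma exists_notMem_sep {m : ℕ} (X : Finset (Fin m)) (hX : X ≠ Finset.univ)
    (a : Fin m → ZMod 2) (h : ∀ t ∈ (Δ X)ᶜ, dt a t = 0) : a = 0 := by
  obtain ⟨i, hi⟩ : ∃ i, i ∉ X := by
    by_contra hc; push Not at hc; exact hX (Finset.eq_univ_iff_forall.2 hc)
  have h1 : a i = 0 := by
    have := h (Pi.single i 1) (by
      rw [Finset.mem_compl, mem_Δ]
      intro hc
      simpa using hc i hi)
    simpa [dt, Pi.single_apply] using this
  funext j
  by_cases hj : j = i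
  · rw [hj, h1]; rfl
  · have := h (Pi.single i 1 + Pi.single j 1) (by
      rw [Finset.mem_compl, mem_Δ]
      intro hc
      simpa [Ne.symm hj] using hc i hi)
    simpa [dt, Pi.single_apply, mul_add, Finset.sum_add_distrib, h1] using this

lemma compl_nonempty {m : ℕ} (X : Finset (Fin m)) (hX : X ≠ Finset.univ) :
    ∃ t, t ∈ (Δ X)ᶜ := by
  obtain ⟨i, hi⟩ : ∃ i, i ∉ X := by
    by_contra hc; push Not at hc; exact hX (Finset.eq_univ_iff_forall.2 hc)
  refine ⟨Pi.single i 1, ?_⟩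
  rw [Finset.mem_compl, mem_Δ]
  intro hc
  simpa using hc i hi

lemma EE_zero : EE 0 0 0 = 0 := by simp [EE]

lemma cD_zero_imp {m : ℕ} (L M N : Finset (Fin m))
    (hL : L ≠ Finset.univ) (hM : M ≠ Finset.univ) (hN : N ≠ Finset.univ)
    (v : Fin m → Rng) (h : cD (Dset ((Δ L)ᶜ) ((Δ M)ᶜ) ((Δ N)ᶜ)) v = 0) : v = 0 := by
  obtain ⟨⟨⟨α, β⟩, γ⟩, rfl⟩ := EV_bij.2 v
  obtain ⟨x0, hx0⟩ := compl_nonempty L hL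
  obtain ⟨y0, hy0⟩ := compl_nonempty M hM
  obtain ⟨z0, hz0⟩ := compl_nonempty N hN
  have key : ∀ x ∈ (Δ L)ᶜ, ∀ y ∈ (Δ M)ᶜ, ∀ z ∈ (Δ N)ᶜ,
      dt α x = 0 ∧ dt β y = 0 ∧ dt β z + dt γ y = 0 := by
    intro x hx y hy z hz
    have hmem : EV ((x, y), z) ∈ Dset ((Δ L)ᶜ) ((Δ M)ᶜ) ((Δ N)ᶜ) := by
      rw [Dset_eq]
      exact Finset.mem_image_of_mem _ (Finset.mem_product.2 ⟨Finset.mem_product.2 ⟨hx, hy⟩, hz⟩)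
    have := congrFun h ⟨_, hmem⟩
    simp only [cD, EV_dot, Pi.zero_apply] at this
    rw [← EE_zero] at this
    exact EE_inj this
  have hα : α = 0 := exists_notMem_sep L hL α fun x hx => (key x hx y0 hy0 z0 hz0).1
  have hβ : β = 0 := exists_notMem_sep M hM β fun y hy => (key x0 hx0 y hy z0 hz0).2.1
  have hγ : γ = 0 := exists_notMem_sep M hM γ fun y hy => by
    have := (key x0 hx0 y hy z0 hz0).2.2
    rw [hβ] at this
    simpa [dt] using this
  subst hα hβ hγ
  funext i
  simp [EV, EE_zero]

lemma Phi_zero_imp (r : Rng) (h : Phi r = 0) : r = 0 := by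
  obtain ⟨a, b, c, rfl⟩ := EE_surj r
  rw [← EE_zero]
  have h0 : Phi (EE 0 0 0) = 0 := by
    rw [Phi_EE]; decide
  rw [← h0, Phi_EE, Phi_EE] at h
  have e0 := congrFun h 0
  have e1 := congrFun h 1
  have e2 := congrFun h 2
  simp at e0 e1 e2
  clear h h0
  have : a = 0 ∧ b = 0 ∧ c = 0 := by
    revert a b c; decide
  obtain ⟨rfl, rfl, rfl⟩ := this
  rfl

theorem code_LcMcNc (m : ℕ) (hm : 0 < m) (L M N : Finset (Fin m))
    (hL : L ≠ Finset.univ) (hM : M ≠ Finset.univ) (hN : N ≠ Finset.univ)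
    (D : Finset (Fin m → Rng)) (hD : D = Dset ((Δ L)ᶜ) ((Δ M)ᶜ) ((Δ N)ᶜ)) :
    ((D.card : ℤ) =
      (2 ^ m - 2 ^ L.card) * (2 ^ m - 2 ^ M.card) * (2 ^ m - 2 ^ N.card)) ∧
    Function.Injective (cD D) ∧
    Nat.card (Set.range (cD D)) = 2 ^ (3 * m) ∧
    (∀ v : Fin m → Rng, wtL (cD D v) = 0 ↔ v = 0) ∧
    ((Nat.card {v : Fin m → Rng |
        (wtL (cD D v) : ℚ) =
          3 * (2 ^ (m : ℤ) - 2 ^ (L.card : ℤ)) * (2 ^ (m : ℤ) - 2 ^ (M.card : ℤ)) *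
            (2 ^ ((m : ℤ) - 1) - 2 ^ ((N.card : ℤ) - 1))} : ℤ) =
      2 ^ (3 * m) - 2 ^ (3 * m - L.card - M.card)
        - 2 ^ (3 * m - L.card - M.card - N.card + 1)
        + 2 ^ (3 * m - L.card - M.card - (M ∪ N).card + 1)) := by
  subst hD
  have hinj : Function.Injective (cD (Dset ((Δ L)ᶜ) ((Δ M)ᶜ) ((Δ N)ᶜ))) := by
    intro v w h
    have : cD (Dset ((Δ L)ᶜ) ((Δ M)ᶜ) ((Δ N)ᶜ)) (v - w) = 0 := by
      funext d
      have hd := congrFun h d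
      simp only [cD] at hd
      simp [cD, sub_mul, Finset.sum_sub_distrib, hd]
    exact sub_eq_zero.1 (cD_zero_imp L M N hL hM hN _ this)
  have hcard : Nat.card (Fin m → Rng) = 2 ^ (3 * m) := by
    rw [← Nat.card_congr (Equiv.ofBijective _ (EV_bij (m := m)))]
    simp [Nat.card_eq_fintype_card]
    ring
  refine ⟨?_, hinj, ?_, ?_, ?_⟩
  · rw [Dset_eq, Finset.card_image_of_injective _ EV_bij.1, Finset.card_product,
      Finset.card_product]
    push_cast
    rw [card_chi, card_chi, card_chi, chi_zero, chi_zero, chi_zero]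
  · rw [Nat.card_congr (Equiv.ofInjective _ hinj).symm, hcard]
  · intro v
    constructor
    · intro h
      apply cD_zero_imp L M N hL hM hN
      funext d
      apply Phi_zero_imp
      unfold wtL at h
      rw [Finset.sum_eq_zero_iff] at h
      have := h d (Finset.mem_univ _)
      rw [Finset.card_eq_zero, Finset.filter_eq_empty_iff] at this
      funext j
      simpa using this (Finset.mem_univ j)
    · rintro rfl
      have h0 : Phi 0 = 0 := by
        rw [← EE_zero, Phi_EE]; decide
      simp [wtL, cD, h0]
  · set T := ((Fin m → ZMod 2) × (Fin m → ZMod 2)) × (Fin m → ZMod 2) with hT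
    have hset : ∀ t : T, ((wtL (cD (Dset ((Δ L)ᶜ) ((Δ M)ᶜ) ((Δ N)ᶜ)) (EV t)) : ℚ) =
          3 * (2 ^ (m : ℤ) - 2 ^ (L.card : ℤ)) * (2 ^ (m : ℤ) - 2 ^ (M.card : ℤ)) *
            (2 ^ ((m : ℤ) - 1) - 2 ^ ((N.card : ℤ) - 1))) ↔
        ¬ (Z L t.1.1 ∧ (Z M t.1.2 ∨ (Z N t.1.2 ∧ (Z M t.2 ∨ Z M (t.1.2 + t.2))))) := by
      rintro ⟨⟨α, β⟩, γ⟩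
      have hw := wtL_eq L M N α β γ
      rw [← chi_ne L hL, ← bracket_ne M N hM hN, ← mul_ne_zero_iff, not_not]
      generalize chi L α * _ = S at hw ⊢
      have hq : 2 * (wtL (cD (Dset ((Δ L)ᶜ) ((Δ M)ᶜ) ((Δ N)ᶜ)) (EV ((α, β), γ))) : ℚ) =
          3 * ((2 ^ m - 2 ^ L.card) * (2 ^ m - 2 ^ M.card) * (2 ^ m - 2 ^ N.card)) - S := by
        rw [chi_zero, chi_zero, chi_zero] at hw
        exact_mod_cast hw
      rw [zpow_sub_one₀ (by norm_num), zpow_sub_one₀ (by norm_num)]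
      simp only [zpow_natCast]
      rw [← Int.cast_eq_zero (α := ℚ) (n := S)]
      constructor
      · intro h
        rw [h] at hq
        linear_combination hq
      · intro h
        rw [h] at hq
        linear_combination hq / 2
    have e1 : Nat.card {v : Fin m → Rng |
        (wtL (cD (Dset ((Δ L)ᶜ) ((Δ M)ᶜ) ((Δ N)ᶜ)) v) : ℚ) =
          3 * (2 ^ (m : ℤ) - 2 ^ (L.card : ℤ)) * (2 ^ (m : ℤ) - 2 ^ (M.card : ℤ)) *
            (2 ^ ((m : ℤ) - 1) - 2 ^ ((N.card : ℤ) - 1))} =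
        Nat.card {t : T //
          ¬ (Z L t.1.1 ∧ (Z M t.1.2 ∨ (Z N t.1.2 ∧ (Z M t.2 ∨ Z M (t.1.2 + t.2)))))} := by
      symm
      exact Nat.card_congr ((Equiv.ofBijective _ (EV_bij (m := m))).subtypeEquiv
        fun t => (hset t).symm)
    rw [e1, Nat.card_eq_fintype_card, Fintype.card_subtype_compl, Fintype.card_subtype]
    have hle : (Finset.univ.filter (fun t : T =>
      (Z L t.1.1 ∧ (Z M t.1.2 ∨ (Z N t.1.2 ∧ (Z M t.2 ∨ Z M (t.1.2 + t.2))))))).card ≤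
        Fintype.card T := Finset.card_le_univ _
    rw [Nat.cast_sub hle]
    have hTc : (Fintype.card T : ℤ) = 2 ^ (3 * m) := by
      simp [hT]
      ring
    have hbad : ((Finset.univ.filter (fun t : T =>
      (Z L t.1.1 ∧ (Z M t.1.2 ∨ (Z N t.1.2 ∧ (Z M t.2 ∨ Z M (t.1.2 + t.2))))))).card : ℤ) =
        2 ^ (m - L.card) * (2 ^ m * 2 ^ (m - M.card) +
        2 * 2 ^ (m - M.card) * (2 ^ (m - N.card) - 2 ^ (m - (M ∪ N).card))) := by
      rw [← card_pair, show (2 : ℤ) ^ (m - L.card) =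
        ((Finset.univ.filter (fun a : Fin m → ZMod 2 => Z L a)).card : ℤ) by
          rw [card_Z]; push_cast; rfl]
      rw [← Nat.cast_mul, ← Finset.card_product]
      congr 1
      refine Finset.card_equiv (Equiv.prodAssoc _ _ _) ?_
      intro t
      simp
      rfl
    rw [hTc, hbad]
    have cl : ∀ X : Finset (Fin m), X.card ≤ m := fun X => by
      simpa using Finset.card_le_univ X
    have h1 := cl L
    have h2 := cl M
    have h3 := cl N
    have h4 := cl (M ∪ N)
    rw [show 3 * m - L.card - M.card = (m - L.card) + m + (m - M.card) by omega,
      show (m - L.card) + m + (m - M.card) - N.card + 1 =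
        (m - L.card) + (m - M.card) + (m - N.card) + 1 by omega,
      show (m - L.card) + m + (m - M.card) - (M ∪ N).card + 1 =
        (m - L.card) + (m - M.card) + (m - (M ∪ N).card) + 1 by omega]
    simp only [pow_add]
    ring

end
end

section
/- Let m be a positive integer and let L, M, N be nonempty subsets of [m]. Let D_1 ∈ {Δ_L, Δ_L^c}, D_2 ∈ {Δ_M, Δ_M^c}, D_3 ∈ {Δ_N, Δ_N^c}, and D = (1+u^2)D_1 + u^2(D_2 + (u+u^2)D_3) ⊆ R^m. Then the binary linear code Φ(C_D) is self-orthogonal: for all codewords c, c' ∈ Φ(C_D), the Euclidean inner product Σ_i c_i c'_i equals 0 in Z_2. -/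
open Polynomial
open scoped Classical

noncomputable section

/-- Coefficients of the reduced representative. -/
lemma coeff_repr (a b c : ZMod 2) :
    AdjoinRoot.modByMonicHom cubic_monic (toRng a + toRng b * u + toRng c * u ^ 2) =
      C c * X ^ 2 + C b * X + C a := by
  have h : toRng a + toRng b * u + toRng c * u ^ 2 =
      AdjoinRoot.mk (X ^ 3 - X : Polynomial (ZMod 2)) (C c * X ^ 2 + C b * X + C a) := by
    simp only [map_add, map_mul, map_pow, AdjoinRoot.mk_C, AdjoinRoot.mk_X, toRng, u]
    ring
  rw [h, AdjoinRoot.modByMonicHom_mk, Polynomial.modByMonic_eq_self_iff cubic_monic]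
  have h3 : (X ^ 3 - X : Polynomial (ZMod 2)).degree = 3 := by
    compute_degree!
  rw [h3]
  exact lt_of_le_of_lt Polynomial.degree_quadratic_le (by norm_num)

lemma gen_eq (a b c : ZMod 2) :
    (1 + u ^ 2) * toRng a + u ^ 2 * (toRng b + (u + u ^ 2) * toRng c) =
      toRng a + toRng c * u + toRng (a + b + c) * u ^ 2 := by
  rw [map_add, map_add]
  linear_combination (toRng c + toRng c * u) * u_cube

lemma gen_inj {a b c a' b' c' : ZMod 2}
    (h : (1 + u ^ 2) * toRng a + u ^ 2 * (toRng b + (u + u ^ 2) * toRng c) =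
      (1 + u ^ 2) * toRng a' + u ^ 2 * (toRng b' + (u + u ^ 2) * toRng c')) :
    a = a' ∧ b = b' ∧ c = c' := by
  rw [gen_eq, gen_eq] at h
  have h' := congrArg (AdjoinRoot.modByMonicHom cubic_monic) h
  rw [coeff_repr, coeff_repr] at h'
  have h0 := congrArg (fun p => Polynomial.coeff p 0) h'
  have h1 := congrArg (fun p => Polynomial.coeff p 1) h'
  have h2 := congrArg (fun p => Polynomial.coeff p 2) h'
  simp [Polynomial.coeff_X, Polynomial.coeff_C, Polynomial.coeff_X_pow, -map_add] at h0 h1 h2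
  subst h0 h1
  simpa using h2

lemma Phi_add (x y : Rng) (j : Fin 3) : Phi (x + y) j = Phi x j + Phi y j := by
  fin_cases j <;> simp [Phi] <;> ring

lemma card_zero {m : ℕ} (i : Fin m) (S : Finset (Fin m → ZMod 2))
    (hS : ∀ v ∈ S, v + Pi.single i 1 ∈ S) : (S.card : ZMod 2) = 0 := by
  have h : ∑ v ∈ S, (1 : ZMod 2) = 0 := by
    refine Finset.sum_involution (fun v _ => v + Pi.single i 1) ?_ ?_ hS ?_
    · intro v _
      decide
    · intro v _ _ h
      have := congrFun h i
      simp at this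
    · intro v _
      funext k
      simp only [Pi.add_apply]
      rw [add_assoc, CharTwo.add_self_eq_zero, add_zero]
  simpa using h

lemma mem_toggle {m : ℕ} (L : Finset (Fin m)) (i : Fin m) (hi : i ∈ L) (v : Fin m → ZMod 2) :
    v + Pi.single i 1 ∈ Δ L ↔ v ∈ Δ L := by
  simp only [Δ, supp, Finset.mem_filter, Finset.mem_univ, true_and, Finset.subset_iff]
  refine forall_congr' fun k => ?_
  by_cases hk : k = i
  · subst hk
    simp [hi]
  · simp [Pi.single_apply, hk]

lemma card_D {m : ℕ} (L : Finset (Fin m)) (hL : L.Nonempty) (S : Finset (Fin m → ZMod 2))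
    (hS : S = Δ L ∨ S = (Δ L)ᶜ) : (S.card : ZMod 2) = 0 := by
  obtain ⟨i, hi⟩ := hL
  refine card_zero i S fun v hv => ?_
  rcases hS with rfl | rfl
  · exact (mem_toggle L i hi v).mpr hv
  · rw [Finset.mem_compl] at hv ⊢
    rwa [mem_toggle L i hi v]

lemma sum_zero {α : Type*} (A B E : Finset α) (hA : (A.card : ZMod 2) = 0)
    (hB : (B.card : ZMod 2) = 0) (hE : (E.card : ZMod 2) = 0)
    (f1 f2 f3 g1 g2 g3 : α → ZMod 2) :
    ∑ t ∈ (A ×ˢ B) ×ˢ E, (f1 t.1.1 + f2 t.1.2 + f3 t.2) * (g1 t.1.1 + g2 t.1.2 + g3 t.2) = 0 := by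
  simp only [Finset.sum_product, add_mul, mul_add, Finset.sum_add_distrib, Finset.sum_const,
    nsmul_eq_mul, hA, hB, hE, zero_mul, Finset.sum_const_zero, ← Finset.mul_sum, mul_zero]
  simp [hA]

theorem gray_image_self_orthogonal (m : ℕ) (hm : 0 < m) (L M N : Finset (Fin m))
    (hL : L.Nonempty) (hM : M.Nonempty) (hN : N.Nonempty)
    (D1 D2 D3 : Finset (Fin m → ZMod 2))
    (hD1 : D1 = Δ L ∨ D1 = (Δ L)ᶜ) (hD2 : D2 = Δ M ∨ D2 = (Δ M)ᶜ)
    (hD3 : D3 = Δ N ∨ D3 = (Δ N)ᶜ)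
    (D : Finset (Fin m → Rng)) (hD : D = Dset D1 D2 D3) :
    ∀ c ∈ Set.range (fun v : Fin m → Rng => fun p : D × Fin 3 => Phi (cD D v p.1) p.2),
      ∀ c' ∈ Set.range (fun v : Fin m → Rng => fun p : D × Fin 3 => Phi (cD D v p.1) p.2),
        ∑ p : D × Fin 3, c p * c' p = 0 := by
  rintro _ ⟨v, rfl⟩ _ ⟨w, rfl⟩
  have c1 := card_D L hL D1 hD1
  have c2 := card_D M hM D2 hD2
  have c3 := card_D N hN D3 hD3
  rw [Fintype.sum_prod_type_right]
  refine Finset.sum_eq_zero fun j _ => ?_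
  simp only [cD]
  rw [Finset.sum_coe_sort D (fun d => Phi (∑ i, v i * d i) j * Phi (∑ i, w i * d i) j), hD, Dset,
    Finset.sum_image]
  · simp only [mul_add (u ^ 2), mul_add (v _), mul_add (w _), Finset.sum_add_distrib, Phi_add,
      ← add_assoc]
    exact sum_zero D1 D2 D3 c1 c2 c3
      (fun t => Phi (∑ i, v i * ((1 + u ^ 2) * toRng (t i))) j)
      (fun t => Phi (∑ i, v i * (u ^ 2 * toRng (t i))) j)
      (fun t => Phi (∑ i, v i * (u ^ 2 * ((u + u ^ 2) * toRng (t i)))) j)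
      (fun t => Phi (∑ i, w i * ((1 + u ^ 2) * toRng (t i))) j)
      (fun t => Phi (∑ i, w i * (u ^ 2 * toRng (t i))) j)
      (fun t => Phi (∑ i, w i * (u ^ 2 * ((u + u ^ 2) * toRng (t i)))) j)
  · rintro ⟨⟨a, b⟩, c⟩ _ ⟨⟨a', b'⟩, c'⟩ _ h
    have h' := fun i => gen_inj (congrFun h i)
    simp only [Prod.mk.injEq]
    exact ⟨⟨funext fun i => (h' i).1, funext fun i => (h' i).2.1⟩, funext fun i => (h' i).2.2⟩

end
end

section
/- Let m be a positive integer and L, M, N ⊆ [m] with |L|+|M|+|N| ≥ 1, and let D = (1+u^2)Δ_L + u^2(Δ_M + (u+u^2)Δ_N) ⊆ R^m. Then the binary linear code Φ(C_D) is minimal: for any nonzero codewords c, c' ∈ Φ(C_D), if Supp(c') ⊆ Supp(c) then c' = c. (Indeed its minimum nonzero Hamming weight is w_0 = 2^{|L|+|M|+|N|} and maximum Hamming weight is w_∞ = 3·2^{|L|+|M|+|N|−1}, so w_0/w_∞ = 2/3 > 1/2.) -/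
open Polynomial
open scoped Classical

noncomputable section

lemma Phi_normal (a b d : ZMod 2) :
    Phi (toRng a + u * toRng b + u ^ 2 * toRng d) = ![a + b, b + d, d] := by
  have h : toRng a + u * toRng b + u ^ 2 * toRng d =
      AdjoinRoot.mk (X ^ 3 - X : Polynomial (ZMod 2)) (C d * X ^ 2 + C b * X + C a) := by
    simp only [map_add, map_mul, map_pow, AdjoinRoot.mk_X, AdjoinRoot.mk_C, toRng, u]
    ring
  have hm : AdjoinRoot.modByMonicHom cubic_monic
      (toRng a + u * toRng b + u ^ 2 * toRng d) = C d * X ^ 2 + C b * X + C a := by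
    rw [h, AdjoinRoot.modByMonicHom_mk, Polynomial.modByMonic_eq_self_iff cubic_monic]
    have h3 : (X ^ 3 - X : Polynomial (ZMod 2)).degree = 3 := by
      compute_degree!
    rw [h3]
    exact lt_of_le_of_lt Polynomial.degree_quadratic_le (by norm_num)
  unfold Phi
  rw [hm]
  congr 1
  · simp [coeff_X, coeff_C]
  · congr 1
    · simp [coeff_X, coeff_C]
    · simp [coeff_X, coeff_C]

lemma exists_normal (r : Rng) :
    ∃ a b d : ZMod 2, r = toRng a + u * toRng b + u ^ 2 * toRng d := by
  set p := AdjoinRoot.modByMonicHom cubic_monic r with hp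
  have h1 : AdjoinRoot.mk (X ^ 3 - X : Polynomial (ZMod 2)) p = r :=
    AdjoinRoot.mk_leftInverse cubic_monic r
  obtain ⟨q, hq⟩ := AdjoinRoot.mk_surjective r
  have h2 : p = q %ₘ (X ^ 3 - X) := by
    rw [hp, ← hq, AdjoinRoot.modByMonicHom_mk]
  have h3 : (X ^ 3 - X : Polynomial (ZMod 2)).degree = 3 := by
    compute_degree!
  have h4 : p.degree < (3 : ℕ) := by
    have := Polynomial.degree_modByMonic_lt q cubic_monic
    rw [← h2, h3] at this
    exact this
  have h5 : p.natDegree < 3 := by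
    by_cases hp0 : p = 0
    · simp [hp0]
    · exact (Polynomial.natDegree_lt_iff_degree_lt hp0).mpr h4
  refine ⟨p.coeff 0, p.coeff 1, p.coeff 2, ?_⟩
  conv_lhs => rw [← h1, p.as_sum_range_C_mul_X_pow' h5]
  simp only [Finset.sum_range_succ, Finset.sum_range_zero, map_add, map_mul, map_pow,
    AdjoinRoot.mk_X, AdjoinRoot.mk_C, toRng, u, map_zero]
  ring

lemma Phi_add_s19 (r s : Rng) : Phi (r + s) = Phi r + Phi s := by
  unfold Phi
  ext j
  fin_cases j <;> simp <;> ring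

lemma Phi_zero : Phi 0 = 0 := by
  unfold Phi
  ext j
  fin_cases j <;> simp

lemma Phi_sum {m : ℕ} (f : Fin m → Rng) : Phi (∑ i, f i) = ∑ i, Phi (f i) :=
  map_sum (AddMonoidHom.mk' Phi Phi_add_s19) f Finset.univ

/-- The element of `R^m` attached to a triple. -/
def elt {m : ℕ} (t1 t2 t3 : Fin m → ZMod 2) : Fin m → Rng := fun i =>
    (1 + u ^ 2) * toRng (t1 i) +
      u ^ 2 * (toRng (t2 i) + (u + u ^ 2) * toRng (t3 i))

lemma Phi_single (r : Rng) : ∃ p q s : ZMod 2, ∀ t1 t2 t3 : ZMod 2,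
    Phi (r * ((1 + u ^ 2) * toRng t1 + u ^ 2 * (toRng t2 + (u + u ^ 2) * toRng t3))) =
      ![p * t1 + q * t2 + s * t3, p * t1 + s * t2, p * t1 + (q + s) * t2 + s * t3] := by
  obtain ⟨a, b, d, rfl⟩ := exists_normal r
  refine ⟨a, b, a + b + d, fun t1 t2 t3 => ?_⟩
  have h : (toRng a + u * toRng b + u ^ 2 * toRng d) *
      ((1 + u ^ 2) * toRng t1 + u ^ 2 * (toRng t2 + (u + u ^ 2) * toRng t3)) =
      toRng (a * t1) + u * toRng (a * t3 + b * t1 + b * (t1 + t2 + t3) + d * t3) +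
      u ^ 2 * toRng (a * (t1 + t2 + t3) + b * t3 + d * t1 + d * (t1 + t2 + t3)) := by
    have h3 := u_cube
    have h4 : u ^ 4 = u ^ 2 := by linear_combination u * h3
    have h5 : u ^ 5 = u := by linear_combination (u ^ 2 + 1) * h3
    have h6 : u ^ 6 = u ^ 2 := by linear_combination (u ^ 3 + u) * h3
    simp only [map_add, map_mul]
    ring_nf
    simp only [h3, h4, h5, h6]
    ring
  rw [h, Phi_normal]
  clear h
  revert a b d t1 t2 t3
  decide

lemma Phi_word {m : ℕ} (v : Fin m → Rng) : ∃ P Q S : Fin m → ZMod 2,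
    ∀ t1 t2 t3 : Fin m → ZMod 2,
    Phi (∑ i, v i * elt t1 t2 t3 i) =
      ![P ⬝ᵥ t1 + Q ⬝ᵥ t2 + S ⬝ᵥ t3, P ⬝ᵥ t1 + S ⬝ᵥ t2,
        P ⬝ᵥ t1 + (Q ⬝ᵥ t2 + S ⬝ᵥ t2) + S ⬝ᵥ t3] := by
  choose P Q S h using fun i => Phi_single (v i)
  refine ⟨P, Q, S, fun t1 t2 t3 => ?_⟩
  rw [Phi_sum]
  simp only [elt, h, dotProduct]
  ext j
  rw [Finset.sum_apply]
  fin_cases j <;> simp [Finset.sum_add_distrib, add_mul]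

lemma zero_mem_Δ {m : ℕ} (Y : Finset (Fin m)) : (0 : Fin m → ZMod 2) ∈ Δ Y := by
  simp only [Δ, supp, Finset.mem_filter, Finset.mem_univ, true_and, Finset.subset_iff,
    Pi.zero_apply]
  intro i hi
  exact absurd hi (by decide)

lemma add_mem_Δ {m : ℕ} {Y : Finset (Fin m)} {x y : Fin m → ZMod 2}
    (hx : x ∈ Δ Y) (hy : y ∈ Δ Y) : x + y ∈ Δ Y := by
  simp only [Δ, supp, Finset.mem_filter, Finset.mem_univ, true_and, Finset.subset_iff,
    Pi.add_apply] at *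
  intro i hi
  by_contra hc
  have h1 : x i ≠ 1 := fun h => hc (hx h)
  have h2 : y i ≠ 1 := fun h => hc (hy h)
  generalize x i = a at *
  generalize y i = b at *
  clear hx hy hc
  revert a b
  decide

lemma mem_Dset {m : ℕ} {A B E : Finset (Fin m → ZMod 2)} {d : Fin m → Rng} :
    d ∈ Dset A B E ↔ ∃ t1 ∈ A, ∃ t2 ∈ B, ∃ t3 ∈ E, d = elt t1 t2 t3 := by
  unfold Dset
  rw [Finset.mem_image]
  constructor
  · rintro ⟨⟨⟨t1, t2⟩, t3⟩, ht, rfl⟩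
    simp only [Finset.mem_product] at ht
    exact ⟨t1, ht.1.1, t2, ht.1.2, t3, ht.2, rfl⟩
  · rintro ⟨t1, h1, t2, h2, t3, h3, rfl⟩
    exact ⟨⟨⟨t1, t2⟩, t3⟩, by simp [h1, h2, h3], rfl⟩

lemma Dset_add {m : ℕ} {L M N : Finset (Fin m)} {x y : Fin m → Rng}
    (hx : x ∈ Dset (Δ L) (Δ M) (Δ N)) (hy : y ∈ Dset (Δ L) (Δ M) (Δ N)) :
    x + y ∈ Dset (Δ L) (Δ M) (Δ N) := by
  rw [mem_Dset] at *
  obtain ⟨a, ha, b, hb, c, hc, rfl⟩ := hx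
  obtain ⟨a', ha', b', hb', c', hc', rfl⟩ := hy
  refine ⟨_, add_mem_Δ ha ha', _, add_mem_Δ hb hb', _, add_mem_Δ hc hc', ?_⟩
  ext i
  simp only [elt, Pi.add_apply, map_add]
  ring

/-- If two of the three component functionals vanish on `D`, so does every one. -/
lemma two_vanish {m : ℕ} (L M N : Finset (Fin m)) (v : Fin m → Rng) (j k : Fin 3) (hjk : j ≠ k)
    (hj : ∀ d ∈ Dset (Δ L) (Δ M) (Δ N), Phi (∑ i, v i * d i) j = 0)
    (hk : ∀ d ∈ Dset (Δ L) (Δ M) (Δ N), Phi (∑ i, v i * d i) k = 0) :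
    ∀ l, ∀ d ∈ Dset (Δ L) (Δ M) (Δ N), Phi (∑ i, v i * d i) l = 0 := by
  obtain ⟨P, Q, S, h⟩ := Phi_word v
  have key : ∀ l : Fin 3, (∀ d ∈ Dset (Δ L) (Δ M) (Δ N), Phi (∑ i, v i * d i) l = 0) →
      (∀ t ∈ Δ L, P ⬝ᵥ t = 0) ∧
      (∀ t ∈ Δ M, (![Q ⬝ᵥ t, S ⬝ᵥ t, Q ⬝ᵥ t + S ⬝ᵥ t] : Fin 3 → ZMod 2) l = 0) ∧
      (∀ t ∈ Δ N, (![S ⬝ᵥ t, 0, S ⬝ᵥ t] : Fin 3 → ZMod 2) l = 0) := by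
    intro l hl
    refine ⟨fun t ht => ?_, fun t ht => ?_, fun t ht => ?_⟩
    · have := hl _ (mem_Dset.mpr ⟨t, ht, 0, zero_mem_Δ _, 0, zero_mem_Δ _, rfl⟩)
      rw [h] at this
      fin_cases l <;> simpa using this
    · have := hl _ (mem_Dset.mpr ⟨0, zero_mem_Δ _, t, ht, 0, zero_mem_Δ _, rfl⟩)
      rw [h] at this
      fin_cases l <;> simpa using this
    · have := hl _ (mem_Dset.mpr ⟨0, zero_mem_Δ _, 0, zero_mem_Δ _, t, ht, rfl⟩)
      rw [h] at this
      fin_cases l <;> simpa using this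
  obtain ⟨hP, hM, hN⟩ := key j hj
  obtain ⟨-, hM', hN'⟩ := key k hk
  intro l d hd
  obtain ⟨t1, h1, t2, h2, t3, h3, rfl⟩ := mem_Dset.mp hd
  rw [h]
  have e1 := hP t1 h1
  have e2 := hM t2 h2
  have e3 := hN t3 h3
  have e4 := hM' t2 h2
  have e5 := hN' t3 h3
  rw [e1]
  clear hP hM hN hM' hN' key hj hk h
  generalize Q ⬝ᵥ t2 = q at *
  generalize S ⬝ᵥ t2 = s at *
  generalize S ⬝ᵥ t3 = s' at *
  clear e1 h1 h2 h3 hd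
  revert j k l q s s'
  decide

/-- Over `Z₂`, a functional whose support lies in that of `f` is `0` or `f`. -/
lemma zero_or_eq {A : Type} [Add A] (s : Finset A) (hs : ∀ x ∈ s, ∀ y ∈ s, x + y ∈ s)
    (f g : A → ZMod 2) (hf : ∀ x y, f (x + y) = f x + f y) (hg : ∀ x y, g (x + y) = g x + g y)
    (hgf : ∀ x ∈ s, g x ≠ 0 → f x ≠ 0) :
    (∀ x ∈ s, g x = 0) ∨ (∀ x ∈ s, g x = f x) := by
  by_contra! hc
  obtain ⟨⟨x, hx, hx0⟩, y, hy, hy0⟩ := hc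
  have h1 := hgf x hx
  have h2 := hgf y hy
  have h3 := hgf _ (hs x hx y hy)
  rw [hf, hg] at h3
  generalize f x = a at *
  generalize f y = b at *
  generalize g x = a' at *
  generalize g y = b' at *
  clear hs hf hg hgf
  revert a b a' b'
  decide

theorem gray_image_minimal (m : ℕ) (hm : 0 < m) (L M N : Finset (Fin m))
    (hs : 1 ≤ L.card + M.card + N.card)
    (D : Finset (Fin m → Rng)) (hD : D = Dset (Δ L) (Δ M) (Δ N)) :
    ∀ c ∈ Set.range (fun v : Fin m → Rng => fun p : D × Fin 3 => Phi (cD D v p.1) p.2),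
      ∀ c' ∈ Set.range (fun v : Fin m → Rng => fun p : D × Fin 3 => Phi (cD D v p.1) p.2),
        c ≠ 0 → c' ≠ 0 → (∀ p : D × Fin 3, c' p ≠ 0 → c p ≠ 0) → c' = c := by
  subst hD
  set T := Dset (Δ L) (Δ M) (Δ N) with hT
  rintro c ⟨v, rfl⟩ c' ⟨w, rfl⟩ - hw hsub
  set F : (Fin m → Rng) → Fin 3 → (Fin m → Rng) → ZMod 2 :=
    fun v j d => Phi (∑ i, v i * d i) j with hF
  have Fadd : ∀ v j x y, F v j (x + y) = F v j x + F v j y := by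
    intro v j x y
    simp only [hF, Pi.add_apply, mul_add, Finset.sum_add_distrib, Phi_add_s19]
  have Fadd' : ∀ v w j x, F (v + w) j x = F v j x + F w j x := by
    intro v w j x
    simp only [hF, Pi.add_apply, add_mul, Finset.sum_add_distrib, Phi_add_s19]
  have hdich : ∀ j, (∀ x ∈ T, F w j x = 0) ∨ (∀ x ∈ T, F w j x = F v j x) := fun j =>
    zero_or_eq T (fun x hx y hy => Dset_add hx hy) (F v j) (F w j) (Fadd v j) (Fadd w j)
      (fun x hx => hsub (⟨x, hx⟩, j))
  have hsome : ∀ j k, j ≠ k → (∀ x ∈ T, F w j x = 0) → (∀ x ∈ T, F w k x = 0) → False := by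
    intro j k hjk hj hk
    apply hw
    funext p
    exact two_vanish L M N w j k hjk hj hk p.2 p.1.1 p.1.2
  have hfin : ∀ j k, j ≠ k → (∀ x ∈ T, F w j x = F v j x) → (∀ x ∈ T, F w k x = F v k x) →
      ∀ l, ∀ x ∈ T, F w l x = F v l x := by
    intro j k hjk hj hk l x hx
    have h := two_vanish L M N (w + v) j k hjk
      (fun d hd => (Fadd' w v j d).trans (by rw [hj d hd]; exact CharTwo.add_self_eq_zero _))
      (fun d hd => (Fadd' w v k d).trans (by rw [hk d hd]; exact CharTwo.add_self_eq_zero _))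
      l x hx
    exact CharTwo.add_eq_zero.mp ((Fadd' w v l x).symm.trans h)
  have hall : ∀ l, ∀ x ∈ T, F w l x = F v l x := by
    rcases hdich 0 with h0 | h0
    · rcases hdich 1 with h1 | h1
      · exact (hsome 0 1 (by decide) h0 h1).elim
      · rcases hdich 2 with h2 | h2
        · exact (hsome 0 2 (by decide) h0 h2).elim
        · exact hfin 1 2 (by decide) h1 h2
    · rcases hdich 1 with h1 | h1
      · rcases hdich 2 with h2 | h2
        · exact (hsome 1 2 (by decide) h1 h2).elim
        · exact hfin 0 2 (by decide) h0 h2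
      · exact hfin 0 1 (by decide) h0 h1
  funext p
  exact hall p.2 p.1.1 p.1.2

end
end
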